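/- arXiv:2508.04133 — 2 statements merged into one kernel-verified Lean document; each statement's English description precedes it below -/
import Mathlib

section
/- Let G ~ G(n,1/2), let k ≤ 2 log₂ n − 5 log₂ log₂ n, and let Z_k be the number of k-element independent sets of G. Then for any ε > 0, Pr[|Z_k − E[Z_k]| ≥ ε·E[Z_k]] ≤ O(k⁵ / (ε² n²)). -/
open Classical in
/-- The number of independent sets of size `k` in a graph `G`. -/
noncomputable def numIndepSets (n k : ℕ) (G : SimpleGraph (Fin n)) : ℕ :=
  (Finset.univ.filter (fun S : Finset (Fin n) =>
    S.card = k ∧ ∀ u ∈ S, ∀ v ∈ S, ¬ G.Adj u v)).card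

open Classical in
/-- The expected number of independent sets of size `k` in `G(n,1/2)`. -/
noncomputable def expNumIndepSets (n k : ℕ) : ℝ :=
  (∑ G : SimpleGraph (Fin n), (numIndepSets n k G : ℝ)) /
    (Fintype.card (SimpleGraph (Fin n)) : ℝ)

/-- The non-diagonal pairs spanned by a vertex set. -/
def pairsWithin {V : Type*} [DecidableEq V] (S : Finset V) : Finset (Sym2 V) :=
  S.offDiag.image Sym2.mk.uncurry

lemma mk_mem_pairsWithin {V : Type*} [DecidableEq V] {S : Finset V} {u v : V} :
    s(u, v) ∈ pairsWithin S ↔ u ∈ S ∧ v ∈ S ∧ u ≠ v := by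
  simp only [pairsWithin, Finset.mem_image, Finset.mem_offDiag, Prod.exists,
    Function.uncurry_apply_pair, Sym2.eq_iff]
  grind

lemma not_isDiag_of_mem_pairsWithin {V : Type*} [DecidableEq V] {S : Finset V} {e : Sym2 V}
    (he : e ∈ pairsWithin S) : ¬ e.IsDiag := by
  induction e with
  | _ u v => simpa using (mk_mem_pairsWithin.1 he).2.2

lemma card_pairsWithin {V : Type*} [DecidableEq V] (S : Finset V) :
    (pairsWithin S).card = S.card.choose 2 :=
  Sym2.card_image_offDiag S

lemma pairsWithin_inter {V : Type*} [DecidableEq V] (S T : Finset V) :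
    pairsWithin S ∩ pairsWithin T = pairsWithin (S ∩ T) := by
  ext e
  induction e with
  | _ u v =>
    simp only [Finset.mem_inter, mk_mem_pairsWithin]
    tauto

lemma forall_not_adj_iff_pairsWithin {V : Type*} [DecidableEq V] (G : SimpleGraph V)
    (S : Finset V) :
    (∀ u ∈ S, ∀ v ∈ S, ¬ G.Adj u v) ↔ ∀ e ∈ pairsWithin S, e ∉ G.edgeSet := by
  constructor
  · intro h e
    induction e with
    | _ u v =>
      intro he
      rw [mk_mem_pairsWithin] at he
      exact h u he.1 v he.2.1
  · intro h u hu v hv huv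
    exact h s(u, v) (mk_mem_pairsWithin.2 ⟨hu, hv, huv.ne⟩) huv

open Classical in
lemma card_graphs_avoiding {n : ℕ} (B : Finset (Sym2 (Fin n))) (hB : ∀ e ∈ B, ¬ e.IsDiag) :
    (Finset.univ.filter (fun G : SimpleGraph (Fin n) => ∀ e ∈ B, e ∉ G.edgeSet)).card
      = 2 ^ ((Finset.univ.filter (fun e : Sym2 (Fin n) => ¬ e.IsDiag)).card - B.card) := by
  have hsub : B ⊆ Finset.univ.filter (fun e : Sym2 (Fin n) => ¬ e.IsDiag) := fun e he => by
    simpa using hB e he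
  rw [← Finset.card_sdiff_of_subset hsub, ← Finset.card_powerset]
  refine Finset.card_nbij' (fun G => Finset.univ.filter (fun e => e ∈ G.edgeSet))
    (fun s => SimpleGraph.fromEdgeSet (s : Set (Sym2 (Fin n)))) ?_ ?_ ?_ ?_
  · intro G hG
    simp only [Finset.coe_filter, Finset.mem_univ, true_and, Set.mem_ofPred_eq] at hG
    simp only [Finset.coe_powerset, Set.mem_preimage, Set.mem_powerset_iff]
    intro e he
    simp only [Finset.coe_filter, Finset.mem_univ, true_and, Set.mem_ofPred_eq] at he
    simp only [Finset.coe_sdiff, Finset.coe_filter, Finset.mem_univ, true_and, Set.mem_sdiff,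
      Set.mem_ofPred_eq, Finset.mem_coe]
    exact ⟨G.not_isDiag_of_mem_edgeSet he, fun h => hG e h he⟩
  · intro s hs
    simp only [Finset.mem_coe, Finset.mem_powerset] at hs
    simp only [Finset.coe_filter, Finset.mem_univ, true_and, Set.mem_ofPred_eq,
      SimpleGraph.edgeSet_fromEdgeSet]
    intro e he h
    have := hs h.1
    simp [he] at this
  · intro G _
    simp
  · intro s hs
    simp only [Finset.mem_coe, Finset.mem_powerset] at hs
    ext e
    simp only [SimpleGraph.edgeSet_fromEdgeSet, Finset.mem_filter, Finset.mem_univ, true_and,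
      Set.mem_sdiff, Finset.mem_coe, Sym2.mem_diagSet, and_iff_left_iff_imp]
    intro he
    have := hs he
    simp only [Finset.mem_sdiff, Finset.mem_filter, Finset.mem_univ, true_and] at this
    simpa using this.1

open Classical in
lemma card_graphs_avoiding_eq_div {n : ℕ} (B : Finset (Sym2 (Fin n)))
    (hB : ∀ e ∈ B, ¬ e.IsDiag) :
    ((Finset.univ.filter (fun G : SimpleGraph (Fin n) => ∀ e ∈ B, e ∉ G.edgeSet)).card : ℝ)
      = (Fintype.card (SimpleGraph (Fin n)) : ℝ) / 2 ^ B.card := by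
  have htot := card_graphs_avoiding (n := n) ∅ (by simp)
  simp only [Finset.notMem_empty, false_implies, implies_true, Finset.filter_true,
    Finset.card_univ, Finset.card_empty, Nat.sub_zero] at htot
  have hle : B.card ≤ (Finset.univ.filter (fun e : Sym2 (Fin n) => ¬ e.IsDiag)).card :=
    Finset.card_le_card fun e he => by simpa using hB e he
  rw [card_graphs_avoiding B hB, htot, eq_div_iff (by positivity)]
  push_cast
  rw [← pow_add, Nat.sub_add_cancel hle]

open Classical in
lemma card_graphs_indep {n : ℕ} (S : Finset (Fin n)) :
    ((Finset.univ.filter (fun G : SimpleGraph (Fin n) =>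
      ∀ u ∈ S, ∀ v ∈ S, ¬ G.Adj u v)).card : ℝ)
      = (Fintype.card (SimpleGraph (Fin n)) : ℝ) / 2 ^ S.card.choose 2 := by
  simp only [forall_not_adj_iff_pairsWithin]
  rw [card_graphs_avoiding_eq_div _ fun e => not_isDiag_of_mem_pairsWithin, card_pairsWithin]

open Classical in
lemma card_graphs_indep_pair {n : ℕ} (S T : Finset (Fin n)) :
    ((Finset.univ.filter (fun G : SimpleGraph (Fin n) =>
      (∀ u ∈ S, ∀ v ∈ S, ¬ G.Adj u v) ∧ ∀ u ∈ T, ∀ v ∈ T, ¬ G.Adj u v)).card : ℝ)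
      = (Fintype.card (SimpleGraph (Fin n)) : ℝ) * 2 ^ (S ∩ T).card.choose 2 /
        (2 ^ S.card.choose 2 * 2 ^ T.card.choose 2) := by
  have hB : ∀ e ∈ pairsWithin S ∪ pairsWithin T, ¬ e.IsDiag := fun e he =>
    (Finset.mem_union.1 he).elim not_isDiag_of_mem_pairsWithin not_isDiag_of_mem_pairsWithin
  have hcard := Finset.card_union_add_card_inter (pairsWithin S) (pairsWithin T)
  rw [pairsWithin_inter, card_pairsWithin, card_pairsWithin, card_pairsWithin] at hcard
  have hiff : ∀ G : SimpleGraph (Fin n),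
      ((∀ u ∈ S, ∀ v ∈ S, ¬ G.Adj u v) ∧ ∀ u ∈ T, ∀ v ∈ T, ¬ G.Adj u v) ↔
        ∀ e ∈ pairsWithin S ∪ pairsWithin T, e ∉ G.edgeSet := fun G => by
    rw [forall_not_adj_iff_pairsWithin, forall_not_adj_iff_pairsWithin]
    grind
  simp only [hiff]
  rw [card_graphs_avoiding_eq_div _ hB, ← pow_add, ← hcard, pow_add]
  field_simp

open Classical in
lemma numIndepSets_eq_sum (n k : ℕ) (G : SimpleGraph (Fin n)) :
    (numIndepSets n k G : ℝ) = ∑ S ∈ Finset.powersetCard k (Finset.univ : Finset (Fin n)),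
      if ∀ u ∈ S, ∀ v ∈ S, ¬ G.Adj u v then (1 : ℝ) else 0 := by
  rw [Finset.sum_boole, numIndepSets]
  congr 2
  ext S
  simp [Finset.mem_powersetCard]

lemma expNumIndepSets_eq (n k : ℕ) :
    expNumIndepSets n k = (n.choose k : ℝ) / 2 ^ k.choose 2 := by
  classical
  have hN : (Fintype.card (SimpleGraph (Fin n)) : ℝ) ≠ 0 := by
    exact_mod_cast Fintype.card_ne_zero
  rw [expNumIndepSets, div_eq_iff hN]
  simp only [numIndepSets_eq_sum]
  rw [Finset.sum_comm]
  simp only [Finset.sum_boole]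
  rw [Finset.sum_congr rfl fun S hS => by
    rw [card_graphs_indep, (Finset.mem_powersetCard.1 hS).2]]
  simp only [Finset.sum_const, Finset.card_powersetCard, Finset.card_univ, Fintype.card_fin,
    nsmul_eq_mul]
  ring

lemma sum_sq_numIndepSets (n k : ℕ) :
    ∑ G : SimpleGraph (Fin n), (numIndepSets n k G : ℝ) ^ 2 =
      (Fintype.card (SimpleGraph (Fin n)) : ℝ) / (2 ^ k.choose 2) ^ 2 *
        ∑ S ∈ Finset.powersetCard k (Finset.univ : Finset (Fin n)),
          ∑ T ∈ Finset.powersetCard k (Finset.univ : Finset (Fin n)),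
            (2 : ℝ) ^ (S ∩ T).card.choose 2 := by
  classical
  simp only [numIndepSets_eq_sum, sq, Finset.sum_mul_sum, ite_zero_mul_ite_zero, mul_one]
  rw [Finset.sum_comm, Finset.mul_sum]
  refine Finset.sum_congr rfl fun S hS => ?_
  rw [Finset.sum_comm, Finset.mul_sum]
  refine Finset.sum_congr rfl fun T hT => ?_
  rw [Finset.sum_boole, card_graphs_indep_pair, (Finset.mem_powersetCard.1 hS).2,
    (Finset.mem_powersetCard.1 hT).2]
  ring

lemma card_filter_superset_le {V : Type*} [Fintype V] [DecidableEq V] (k : ℕ) (L : Finset V) :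
    ((Finset.powersetCard k (Finset.univ : Finset V)).filter (L ⊆ ·)).card ≤
      (Fintype.card V - L.card).choose (k - L.card) := by
  rw [← Finset.card_compl, ← Finset.card_powersetCard]
  refine Finset.card_le_card_of_injOn (· \ L) ?_ ?_
  · intro T hT
    simp only [Finset.coe_filter, Finset.mem_powersetCard, Finset.subset_univ, true_and,
      Set.mem_ofPred_eq] at hT
    simp only [Finset.mem_coe, Finset.mem_powersetCard, Finset.card_sdiff_of_subset hT.2, hT.1,
      and_true]
    intro x hx
    simp at hx ⊢
    exact hx.2
  · intro T hT T' hT' h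
    simp only [Finset.coe_filter, Set.mem_ofPred_eq] at hT hT'
    rw [← Finset.sdiff_union_of_subset hT.2, ← Finset.sdiff_union_of_subset hT'.2]
    exact congrArg (· ∪ L) h

lemma choose_sub_mul_pow_le {n k : ℕ} (hkn : k ≤ n) :
    ∀ {l : ℕ}, l ≤ k → (n - l).choose (k - l) * n ^ l ≤ n.choose k * k ^ l
  | 0, _ => by simp
  | l + 1, hl => by
    have ih := choose_sub_mul_pow_le hkn (Nat.le_of_succ_le hl)
    obtain ⟨a, rfl⟩ := Nat.exists_eq_add_of_le hl
    obtain ⟨b, rfl⟩ := Nat.exists_eq_add_of_le hkn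
    have e1 : l + 1 + a + b - (l + 1) = a + b := by omega
    have e2 : l + 1 + a - (l + 1) = a := by omega
    have e3 : l + 1 + a + b - l = a + b + 1 := by omega
    have e4 : l + 1 + a - l = a + 1 := by omega
    rw [e3, e4] at ih
    rw [e1, e2]
    have hrec := Nat.add_one_mul_choose_eq (a + b) a
    have hratio : (a + 1) * (l + 1 + a + b) ≤ (l + 1 + a) * (a + b + 1) := by nlinarith
    refine Nat.le_of_mul_le_mul_left ?_ (Nat.succ_pos (a + b))
    calc (a + b + 1) * ((a + b).choose a * (l + 1 + a + b) ^ (l + 1))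
        = ((a + b + 1) * (a + b).choose a) * (l + 1 + a + b) ^ l * (l + 1 + a + b) := by ring
      _ = ((a + b + 1).choose (a + 1) * (l + 1 + a + b) ^ l) *
            ((a + 1) * (l + 1 + a + b)) := by rw [hrec]; ring
      _ ≤ ((l + 1 + a + b).choose (l + 1 + a) * (l + 1 + a) ^ l) *
            ((l + 1 + a) * (a + b + 1)) := Nat.mul_le_mul ih hratio
      _ = (a + b + 1) * ((l + 1 + a + b).choose (l + 1 + a) * (l + 1 + a) ^ (l + 1)) := by ring

/-- The contribution of overlaps of size at least two, bounded through the common subset. -/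
lemma sum_overlap_le {n k : ℕ} {S : Finset (Fin n)} (hS : S.card = k) :
    ∑ T ∈ Finset.powersetCard k (Finset.univ : Finset (Fin n)),
        ((2 : ℝ) ^ (S ∩ T).card.choose 2 - 1) ≤
      ∑ l ∈ Finset.range (k + 1), k.choose l •
        (if 2 ≤ l then (2 : ℝ) ^ l.choose 2 * (n - l).choose (k - l) else 0) := by
  subst hS
  rw [← Finset.sum_powerset_apply_card
    (fun l => if 2 ≤ l then (2 : ℝ) ^ l.choose 2 * (n - l).choose (S.card - l) else 0)]
  have hpt : ∀ T : Finset (Fin n), (2 : ℝ) ^ (S ∩ T).card.choose 2 - 1 ≤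
      ∑ L ∈ S.powerset,
        if L ⊆ T then (if 2 ≤ L.card then (2 : ℝ) ^ L.card.choose 2 else 0) else 0 := by
    intro T
    refine le_trans ?_ (Finset.single_le_sum (fun L _ => by positivity)
      (Finset.mem_powerset.2 (Finset.inter_subset_left (s₁ := S) (s₂ := T))))
    rw [if_pos Finset.inter_subset_right]
    split_ifs with h
    · linarith
    · rw [Nat.choose_eq_zero_of_lt (not_le.1 h)]
      simp
  refine (Finset.sum_le_sum fun T _ => hpt T).trans ?_
  rw [Finset.sum_comm]
  refine Finset.sum_le_sum fun L _ => ?_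
  rw [← Finset.sum_filter, Finset.sum_const, nsmul_eq_mul]
  have hcard := card_filter_superset_le S.card L
  rw [Fintype.card_fin] at hcard
  split_ifs with h
  · rw [mul_comm]
    gcongr
  · simp

lemma overlap_term_le {n k l : ℕ} (hn : 0 < n) (hk : k ^ 4 * 2 ^ (k + 1) ≤ n ^ 2) (hl : 2 ≤ l)
    (hlk : l ≤ k) :
    ((k : ℝ) ^ 2 / n) ^ l * 2 ^ l.choose 2 ≤ 2 * (k : ℝ) ^ 4 / n ^ 2 := by
  have hn' : (0 : ℝ) < n := by exact_mod_cast hn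
  obtain ⟨m, rfl⟩ := Nat.exists_eq_add_of_le' hl
  have hch : (m + 2).choose 2 * 2 = m * (m + 3) + 2 := by
    rw [Nat.choose_two_right, Nat.div_mul_cancel (Nat.even_mul_pred_self _).two_dvd]
    simp only [Nat.add_succ_sub_one]
    ring
  have hx : (k : ℝ) ^ 4 / n ^ 2 * 2 ^ (m + 3) ≤ 1 := by
    rw [div_mul_eq_mul_div, div_le_one (by positivity)]
    have h1 : k ^ 4 * 2 ^ (m + 3) ≤ n ^ 2 :=
      (Nat.mul_le_mul_left _ (Nat.pow_le_pow_right two_pos (by omega))).trans hk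
    exact_mod_cast h1
  refine le_of_sq_le_sq ?_ (by positivity)
  calc (((k : ℝ) ^ 2 / n) ^ (m + 2) * 2 ^ (m + 2).choose 2) ^ 2
      = ((k : ℝ) ^ 4 / n ^ 2) ^ (m + 2) * 2 ^ ((m + 2).choose 2 * 2) := by
        rw [mul_pow, ← pow_mul, ← pow_mul, mul_comm (m + 2) 2, pow_mul, div_pow, ← pow_mul]
    _ = (2 * (k : ℝ) ^ 4 / n ^ 2) ^ 2 * ((k : ℝ) ^ 4 / n ^ 2 * 2 ^ (m + 3)) ^ m := by
        rw [hch, mul_pow, ← pow_mul, mul_comm (m + 3) m]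
        ring
    _ ≤ (2 * (k : ℝ) ^ 4 / n ^ 2) ^ 2 * 1 := by
        gcongr
        exact pow_le_one₀ (by positivity) hx
    _ = _ := mul_one _

lemma sum_overlap_terms_le {n k : ℕ} (hn : 0 < n) (hkn : k ≤ n)
    (hk : k ^ 4 * 2 ^ (k + 1) ≤ n ^ 2) :
    ∑ l ∈ Finset.range (k + 1), k.choose l •
        (if 2 ≤ l then (2 : ℝ) ^ l.choose 2 * (n - l).choose (k - l) else 0) ≤
      n.choose k * (4 * k ^ 5 / n ^ 2) := by
  have hn' : (0 : ℝ) < n := by exact_mod_cast hn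
  have hterm : ∀ l ∈ Finset.range (k + 1), k.choose l •
      (if 2 ≤ l then (2 : ℝ) ^ l.choose 2 * (n - l).choose (k - l) else 0) ≤
        n.choose k * (2 * k ^ 4 / n ^ 2) := by
    intro l hl
    have hlk : l ≤ k := Nat.lt_succ_iff.1 (Finset.mem_range.1 hl)
    split_ifs with h
    · have h1 : ((n - l).choose (k - l) : ℝ) ≤ n.choose k * (k / n) ^ l := by
        rw [div_pow, mul_div_assoc', le_div_iff₀ (by positivity)]
        exact_mod_cast choose_sub_mul_pow_le hkn hlk
      have h2 : (k.choose l : ℝ) ≤ k ^ l := by exact_mod_cast Nat.choose_le_pow k l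
      rw [nsmul_eq_mul]
      calc (k.choose l : ℝ) * (2 ^ l.choose 2 * (n - l).choose (k - l))
          ≤ k ^ l * (2 ^ l.choose 2 * (n.choose k * (k / n) ^ l)) := by gcongr
        _ = n.choose k * (((k : ℝ) ^ 2 / n) ^ l * 2 ^ l.choose 2) := by
            rw [sq, mul_div_assoc, mul_pow]; ring
        _ ≤ _ := by gcongr; exact overlap_term_le hn hk h hlk
    · rw [smul_zero]; positivity
  refine (Finset.sum_le_sum hterm).trans ?_
  rw [Finset.sum_const, Finset.card_range, nsmul_eq_mul]
  rcases Nat.eq_zero_or_pos k with rfl | hpos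
  · simp
  · have hk1 : (1 : ℝ) ≤ k := by exact_mod_cast hpos
    calc ((k + 1 : ℕ) : ℝ) * (n.choose k * (2 * k ^ 4 / n ^ 2))
        = ((k : ℝ) + 1) * (n.choose k * (2 * k ^ 4 / n ^ 2)) := by push_cast; rfl
      _ ≤ (2 * (k : ℝ)) * (n.choose k * (2 * k ^ 4 / n ^ 2)) := by gcongr; linarith
      _ = _ := by ring

lemma sum_sq_deviation_le {n k : ℕ} (hn : 0 < n) (hkn : k ≤ n)
    (hk : k ^ 4 * 2 ^ (k + 1) ≤ n ^ 2) :
    ∑ G : SimpleGraph (Fin n), ((numIndepSets n k G : ℝ) - expNumIndepSets n k) ^ 2 ≤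
      (Fintype.card (SimpleGraph (Fin n)) : ℝ) * expNumIndepSets n k ^ 2 *
        (4 * k ^ 5 / n ^ 2) := by
  classical
  set N : ℝ := (Fintype.card (SimpleGraph (Fin n)) : ℝ) with hN
  have hN0 : N ≠ 0 := by rw [hN]; exact_mod_cast Fintype.card_ne_zero
  have hmean : ∑ G : SimpleGraph (Fin n), (numIndepSets n k G : ℝ) = expNumIndepSets n k * N := by
    rw [expNumIndepSets, div_mul_cancel₀ _ hN0]
  have hoverlap : ∑ S ∈ Finset.powersetCard k (Finset.univ : Finset (Fin n)),
      ∑ T ∈ Finset.powersetCard k (Finset.univ : Finset (Fin n)),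
        ((2 : ℝ) ^ (S ∩ T).card.choose 2 - 1) ≤
      n.choose k * (n.choose k * (4 * k ^ 5 / n ^ 2)) := by
    refine (Finset.sum_le_sum fun S hS =>
      (sum_overlap_le (Finset.mem_powersetCard.1 hS).2).trans
        (sum_overlap_terms_le hn hkn hk)).trans ?_
    simp
  have hvar : ∑ G : SimpleGraph (Fin n), ((numIndepSets n k G : ℝ) - expNumIndepSets n k) ^ 2 =
      N / (2 ^ k.choose 2) ^ 2 *
        ∑ S ∈ Finset.powersetCard k (Finset.univ : Finset (Fin n)),
          ∑ T ∈ Finset.powersetCard k (Finset.univ : Finset (Fin n)),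
            ((2 : ℝ) ^ (S ∩ T).card.choose 2 - 1) := by
    simp only [sub_sq, Finset.sum_add_distrib, Finset.sum_sub_distrib, ← Finset.sum_mul,
      ← Finset.mul_sum, sum_sq_numIndepSets, hmean]
    simp only [Finset.sum_const, Finset.card_powersetCard, Finset.card_univ, Fintype.card_fin,
      nsmul_eq_mul, ← hN, expNumIndepSets_eq]
    ring
  rw [hvar, expNumIndepSets_eq]
  calc _ ≤ N / (2 ^ k.choose 2) ^ 2 * (n.choose k * (n.choose k * (4 * k ^ 5 / n ^ 2))) := by
        gcongr
    _ = _ := by ring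

open Classical in
lemma card_deviation_div_le {n k : ℕ} (hn : 0 < n) (hkn : k ≤ n)
    (hk : k ^ 4 * 2 ^ (k + 1) ≤ n ^ 2) {ε : ℝ} (hε : 0 < ε) :
    ((Finset.univ.filter (fun G : SimpleGraph (Fin n) =>
          ε * expNumIndepSets n k ≤
            |(numIndepSets n k G : ℝ) - expNumIndepSets n k|)).card : ℝ) /
          (Fintype.card (SimpleGraph (Fin n)) : ℝ) ≤
        4 * k ^ 5 / (ε ^ 2 * n ^ 2) := by
  have hn' : (0 : ℝ) < n := by exact_mod_cast hn
  have hN : 0 < (Fintype.card (SimpleGraph (Fin n)) : ℝ) := by exact_mod_cast Fintype.card_pos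
  have hE : 0 < expNumIndepSets n k := by
    rw [expNumIndepSets_eq]
    have := Nat.choose_pos hkn
    positivity
  have hmarkov : ((Finset.univ.filter (fun G : SimpleGraph (Fin n) =>
      ε * expNumIndepSets n k ≤
        |(numIndepSets n k G : ℝ) - expNumIndepSets n k|)).card : ℝ) *
      (ε * expNumIndepSets n k) ^ 2 ≤
      ∑ G : SimpleGraph (Fin n), ((numIndepSets n k G : ℝ) - expNumIndepSets n k) ^ 2 := by
    rw [← nsmul_eq_mul]
    refine (Finset.card_nsmul_le_sum _ (fun G : SimpleGraph (Fin n) =>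
      ((numIndepSets n k G : ℝ) - expNumIndepSets n k) ^ 2) _ fun G hG => ?_).trans
      (Finset.sum_le_sum_of_subset_of_nonneg (Finset.filter_subset _ _)
        fun G _ _ => sq_nonneg _)
    rw [← sq_abs ((numIndepSets n k G : ℝ) - expNumIndepSets n k)]
    exact pow_le_pow_left₀ (by positivity) (Finset.mem_filter.1 hG).2 2
  have h := hmarkov.trans (sum_sq_deviation_le hn hkn hk)
  rw [div_le_div_iff₀ hN (by positivity)]
  rw [mul_div_assoc', le_div_iff₀ (by positivity)] at h
  refine le_of_mul_le_mul_right ?_ (pow_pos hE 2)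
  linarith

lemma pow_four_mul_two_pow_le {n k : ℕ} (hn : 0 < n) (hL : 32 ≤ Real.logb 2 n)
    (hk : (k : ℝ) ≤ 2 * Real.logb 2 n - 5 * Real.logb 2 (Real.logb 2 n)) :
    k ^ 4 * 2 ^ (k + 1) ≤ n ^ 2 := by
  have hn' : (0 : ℝ) < n := by exact_mod_cast hn
  set L := Real.logb 2 n with hLdef
  have hL0 : 0 < L := by linarith
  have hlogL : 0 ≤ Real.logb 2 L := Real.logb_nonneg (by norm_num) (by linarith)
  have hkL : (k : ℝ) ≤ 2 * L := by linarith
  have hpow : (2 : ℝ) ^ k ≤ n ^ 2 / L ^ 5 := by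
    rw [← Real.rpow_natCast]
    refine (Real.rpow_le_rpow_of_exponent_le (by norm_num) hk).trans_eq ?_
    rw [Real.rpow_sub two_pos, mul_comm 2, mul_comm 5, Real.rpow_mul two_pos.le,
      Real.rpow_mul two_pos.le, Real.rpow_logb two_pos (by norm_num) hL0, hLdef,
      Real.rpow_logb two_pos (by norm_num) hn']
    norm_cast
  have hreal : (k : ℝ) ^ 4 * 2 ^ (k + 1) ≤ n ^ 2 := by
    calc (k : ℝ) ^ 4 * 2 ^ (k + 1) = k ^ 4 * (2 ^ k * 2) := by rw [pow_succ 2]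
      _ ≤ (2 * L) ^ 4 * (n ^ 2 / L ^ 5 * 2) := by gcongr
      _ = n ^ 2 * (32 / L) := by field_simp; ring
      _ ≤ n ^ 2 * 1 := by
          gcongr
          exact (div_le_one hL0).2 hL
      _ = n ^ 2 := mul_one _
  exact_mod_cast hreal

open Classical Filter in
theorem stmt8 :
    ∃ C : ℝ, 0 < C ∧ ∀ᶠ n : ℕ in atTop, ∀ k : ℕ,
      (k : ℝ) ≤ 2 * Real.logb 2 n - 5 * Real.logb 2 (Real.logb 2 n) →
      ∀ ε : ℝ, 0 < ε →
      ((Finset.univ.filter (fun G : SimpleGraph (Fin n) =>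
          ε * expNumIndepSets n k ≤
            |(numIndepSets n k G : ℝ) - expNumIndepSets n k|)).card : ℝ) /
          (Fintype.card (SimpleGraph (Fin n)) : ℝ) ≤
        C * k ^ 5 / (ε ^ 2 * n ^ 2) := by
  refine ⟨4, by norm_num, ?_⟩
  have htend : Tendsto (fun n : ℕ => Real.logb 2 (n : ℝ)) atTop atTop :=
    (Real.tendsto_logb_atTop (by norm_num)).comp tendsto_natCast_atTop_atTop
  filter_upwards [htend.eventually_ge_atTop 32, eventually_gt_atTop 0] with n hL hn k hk ε hε
  have hpow := pow_four_mul_two_pow_le hn hL hk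
  refine card_deviation_div_le hn ?_ hpow hε
  rcases Nat.eq_zero_or_pos k with rfl | hpos
  · exact Nat.zero_le n
  · refine (Nat.pow_le_pow_iff_left two_ne_zero).1 (le_trans ?_ hpow)
    exact (Nat.pow_le_pow_right hpos (by norm_num)).trans (Nat.le_mul_of_pos_right _ (by positivity))
end

section
/- Let G ~ G(n,1/2) and C > 6 a constant. With probability 1 − o(1), every set S ⊆ [n] of size at most log₂ n − C·log₂ log₂ n satisfies |deg↑(S) − d_{|S|}| ≤ d_{|S|}^{2/3}, where d_j = (n−j)·2^{−j}. -/
open Classical in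
/-- The up-degree of a vertex set `S`: the number of vertices outside `S`
adjacent to no vertex of `S`. -/
noncomputable def upDeg (n : ℕ) (G : SimpleGraph (Fin n)) (S : Finset (Fin n)) : ℕ :=
  ((Finset.univ \ S).filter (fun v => ∀ u ∈ S, ¬ G.Adj u v)).card

/-- Graphs with no edge between `S` and its complement. -/
abbrev NonCrossingGraph {V : Type*} (S : Finset V) :=
  {H : SimpleGraph V // ∀ a b, H.Adj a b → (a ∈ S ↔ b ∈ S)}

/-- A graph splits into its edges between `S` and the complement of `S`, and the remaining edges. -/
def graphEquivCrossing {V : Type*} (S : Finset V) :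
    SimpleGraph V ≃ ({v // v ∉ S} → {u // u ∈ S} → Prop) × NonCrossingGraph S where
  toFun G := (fun v u => G.Adj u v,
    ⟨{ Adj := fun a b => G.Adj a b ∧ (a ∈ S ↔ b ∈ S)
       symm := ⟨fun _ _ h => ⟨h.1.symm, h.2.symm⟩⟩
       loopless := ⟨fun _ h => h.1.ne rfl⟩ }, fun _ _ h => h.2⟩)
  invFun p :=
    { Adj := fun a b => p.2.1.Adj a b ∨ (∃ (ha : a ∉ S) (hb : b ∈ S), p.1 ⟨a, ha⟩ ⟨b, hb⟩) ∨
        ∃ (ha : a ∈ S) (hb : b ∉ S), p.1 ⟨b, hb⟩ ⟨a, ha⟩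
      symm := ⟨by
        rintro a b (h | ⟨ha, hb, h⟩ | ⟨ha, hb, h⟩)
        · exact Or.inl h.symm
        · exact Or.inr (Or.inr ⟨hb, ha, h⟩)
        · exact Or.inr (Or.inl ⟨hb, ha, h⟩)⟩
      loopless := ⟨by
        rintro a (h | ⟨ha, hb, h⟩ | ⟨ha, hb, h⟩)
        · exact h.ne rfl
        · exact ha hb
        · exact hb ha⟩ }
  left_inv G := by
    ext a b
    by_cases ha : a ∈ S <;> by_cases hb : b ∈ S <;> simp [ha, hb, G.adj_comm]
  right_inv p := by
    obtain ⟨g, H, hH⟩ := p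
    refine Prod.ext ?_ (Subtype.ext ?_)
    · funext v u
      have hn : ¬ H.Adj u v := fun h => v.2 ((hH _ _ h).1 u.2)
      simp [hn, u.2, v.2]
    · ext a b
      have := hH a b
      by_cases ha : a ∈ S <;> by_cases hb : b ∈ S <;> simp_all

open Classical in
theorem upDeg_eq_card_crossing {n : ℕ} (G : SimpleGraph (Fin n)) (S : Finset (Fin n)) :
    upDeg n G S = (Finset.univ.filter
      (fun v : {v // v ∉ S} => ∀ u, ¬ (graphEquivCrossing S G).1 v u)).card := by
  unfold upDeg
  symm
  refine Finset.card_bij (fun v _ => v.1) ?_ ?_ ?_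
  · rintro ⟨v, hv⟩ h
    simp only [graphEquivCrossing, Equiv.coe_fn_mk, Finset.mem_filter, Finset.mem_univ, true_and,
      Subtype.forall] at h
    simpa [hv] using h
  · intro a _ b _ h
    exact Subtype.ext h
  · intro v h
    simp only [Finset.mem_filter, Finset.mem_sdiff, Finset.mem_univ, true_and] at h
    exact ⟨⟨v, h.1⟩, by simpa [graphEquivCrossing] using h.2, rfl⟩

open Classical in
theorem sum_ite_forall_not {α : Type*} [Fintype α] (x : ℝ) :
    ∑ a : α → Prop, (if ∀ u, ¬ a u then x else 1) =
      2 ^ Fintype.card α * (1 + (x - 1) / 2 ^ Fintype.card α) := by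
  have h : ∀ a : α → Prop, (if ∀ u, ¬ a u then x else 1) =
      1 + if a = (fun _ => False) then x - 1 else 0 := by
    intro a
    have : a = (fun _ => False) ↔ ∀ u, ¬ a u := by simp [funext_iff]
    simp only [this]
    split_ifs <;> ring
  simp only [h, Finset.sum_add_distrib, Finset.sum_ite_eq', Finset.mem_univ, if_true]
  have : (2 : ℝ) ^ Fintype.card α ≠ 0 := by positivity
  simp
  field_simp

open Classical in
theorem sum_pow_upDeg {n : ℕ} (S : Finset (Fin n)) (x : ℝ) :
    ∑ G : SimpleGraph (Fin n), x ^ upDeg n G S =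
      Fintype.card (SimpleGraph (Fin n)) * (1 + (x - 1) / 2 ^ S.card) ^ (n - S.card) := by
  have key : ∀ y : ℝ, ∑ G : SimpleGraph (Fin n), y ^ upDeg n G S =
      Fintype.card (NonCrossingGraph S) *
        (2 ^ S.card * (1 + (y - 1) / 2 ^ S.card)) ^ (n - S.card) := by
    intro y
    let F (g : {v // v ∉ S} → {u // u ∈ S} → Prop) : ℝ := ∏ v, if ∀ u, ¬ g v u then y else 1
    have h1 : ∀ G : SimpleGraph (Fin n), y ^ upDeg n G S = F (graphEquivCrossing S G).1 := by
      intro G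
      rw [upDeg_eq_card_crossing]
      simp [F, Finset.prod_ite]
    refine (Fintype.sum_equiv (graphEquivCrossing S) _ (fun p => F p.1) h1).trans ?_
    rw [Fintype.sum_prod_type]
    simp only [Finset.sum_const, Finset.card_univ, nsmul_eq_mul, ← Finset.mul_sum]
    congr 1
    have h2 := sum_ite_forall_not (α := {u // u ∈ S}) y
    have h3 := Finset.prod_univ_sum
      (fun _ : {v // v ∉ S} => (Finset.univ : Finset ({u // u ∈ S} → Prop)))
      (fun _ a => if ∀ u, ¬ a u then y else 1)
    rw [Fintype.piFinset_univ] at h3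
    have h4 : ∀ v ∈ (Finset.univ : Finset {v // v ∉ S}),
        ∑ a : {u // u ∈ S} → Prop, (if ∀ u, ¬ a u then y else 1) =
          2 ^ S.card * (1 + (y - 1) / 2 ^ S.card) := by
      intro _ _
      convert h2 <;> simp
    rw [← h3, Finset.prod_congr rfl h4]
    simp [Finset.prod_const, Fintype.card_subtype_compl]
  have hone := key 1
  have hx := key x
  simp only [one_pow, Finset.sum_const, Finset.card_univ, nsmul_eq_mul, mul_one, sub_self, zero_div,
    add_zero] at hone
  rw [hx, hone, mul_pow, mul_assoc]

/-- The expected up-degree of a set of size `k` in the uniform random graph on `n` vertices. -/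
noncomputable def meanUpDeg (n k : ℕ) : ℝ := ((n : ℝ) - k) * (2 : ℝ) ^ (-(k : ℝ))

open Classical in
theorem sum_exp_upDeg_le {n : ℕ} (S : Finset (Fin n)) {t : ℝ} (ht : |t| ≤ 1) :
    ∑ G : SimpleGraph (Fin n), Real.exp (t * (upDeg n G S - meanUpDeg n S.card)) ≤
      Fintype.card (SimpleGraph (Fin n)) * Real.exp (meanUpDeg n S.card * t ^ 2) := by
  have hk : S.card ≤ n := by simpa using S.card_le_univ
  have hd : meanUpDeg n S.card = ((n - S.card : ℕ) : ℝ) / 2 ^ S.card := by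
    rw [meanUpDeg, Real.rpow_neg (by norm_num), Real.rpow_natCast, Nat.cast_sub hk, div_eq_mul_inv]
  have hd0 : 0 ≤ meanUpDeg n S.card := by rw [hd]; positivity
  have h1 : ∀ G : SimpleGraph (Fin n), Real.exp (t * (upDeg n G S - meanUpDeg n S.card)) =
      Real.exp t ^ upDeg n G S * Real.exp (-(t * meanUpDeg n S.card)) := by
    intro G
    rw [← Real.exp_nat_mul, ← Real.exp_add]
    ring_nf
  rw [Fintype.sum_congr _ _ h1, ← Finset.sum_mul, sum_pow_upDeg, mul_assoc]
  refine mul_le_mul_of_nonneg_left ?_ (by positivity)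
  have hp : (1 : ℝ) ≤ 2 ^ S.card := one_le_pow₀ (by norm_num)
  have hbase : 0 ≤ 1 + (Real.exp t - 1) / 2 ^ S.card := by
    have : 1 + (Real.exp t - 1) / 2 ^ S.card = (2 ^ S.card - 1 + Real.exp t) / 2 ^ S.card := by
      field_simp
      ring
    rw [this]
    have := Real.exp_pos t
    exact div_nonneg (by linarith) (by positivity)
  have h2 : (1 + (Real.exp t - 1) / 2 ^ S.card) ^ (n - S.card) ≤
      Real.exp (meanUpDeg n S.card * (Real.exp t - 1)) := by
    calc _ ≤ Real.exp ((Real.exp t - 1) / 2 ^ S.card) ^ (n - S.card) := by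
          refine pow_le_pow_left₀ hbase ?_ _
          rw [add_comm]
          exact Real.add_one_le_exp _
      _ = _ := by
          rw [← Real.exp_nat_mul, hd]
          ring_nf
  have h3 : Real.exp t - 1 - t ≤ t ^ 2 :=
    (le_abs_self _).trans (Real.abs_exp_sub_one_sub_id_le ht)
  calc _ ≤ Real.exp (meanUpDeg n S.card * (Real.exp t - 1)) *
          Real.exp (-(t * meanUpDeg n S.card)) := by gcongr
    _ = Real.exp (meanUpDeg n S.card * (Real.exp t - 1 - t)) := by
          rw [← Real.exp_add]
          ring_nf
    _ ≤ _ := by gcongr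

open Classical in
theorem card_upDeg_deviation_le {n : ℕ} (S : Finset (Fin n)) (hd : 1 ≤ meanUpDeg n S.card) :
    ((Finset.univ.filter (fun G : SimpleGraph (Fin n) =>
      ¬ |(upDeg n G S : ℝ) - meanUpDeg n S.card| ≤
        meanUpDeg n S.card ^ ((2 : ℝ) / 3))).card : ℝ) ≤
      Fintype.card (SimpleGraph (Fin n)) *
        (2 * Real.exp (-(meanUpDeg n S.card ^ ((1 : ℝ) / 3) / 4))) := by
  set d := meanUpDeg n S.card with hd_def
  set r := d ^ ((1 : ℝ) / 3) with hr
  have hr1 : 1 ≤ r := Real.one_le_rpow hd (by norm_num)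
  have hr0 : 0 < r := by linarith
  have hr3 : d = r ^ 3 := by
    rw [hr, ← Real.rpow_natCast, ← Real.rpow_mul (by linarith)]
    norm_num
  have hr2 : d ^ ((2 : ℝ) / 3) = r ^ 2 := by
    rw [hr, ← Real.rpow_natCast, ← Real.rpow_mul (by linarith)]
    norm_num
  set t := 1 / (2 * r) with ht
  have ht0 : 0 ≤ t := by positivity
  have ht1 : |t| ≤ 1 := by
    rw [abs_of_nonneg ht0, ht, div_le_one (by positivity)]
    linarith
  have htr2 : t * r ^ 2 = r / 2 := by rw [ht]; field_simp
  have hdt : d * t ^ 2 = r / 4 := by rw [hr3, ht]; field_simp; norm_num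
  have hup := sum_exp_upDeg_le S ht1
  have hdown := sum_exp_upDeg_le (t := -t) S (by rwa [abs_neg])
  rw [← hd_def, neg_sq, hdt] at hdown
  rw [← hd_def, hdt] at hup
  have hpt : ∀ G ∈ Finset.univ.filter (fun G : SimpleGraph (Fin n) =>
      ¬ |(upDeg n G S : ℝ) - d| ≤ d ^ ((2 : ℝ) / 3)),
      Real.exp (r / 2) ≤ Real.exp (t * (upDeg n G S - d)) + Real.exp (-t * (upDeg n G S - d)) := by
    intro G hG
    rw [Finset.mem_filter, hr2, not_le, lt_abs] at hG
    rw [← htr2]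
    rcases hG.2 with h | h
    · refine le_add_of_le_of_nonneg ?_ (Real.exp_pos _).le
      gcongr
    · refine le_add_of_nonneg_of_le (Real.exp_pos _).le ?_
      rw [neg_mul, ← mul_neg]
      gcongr
  have hsum := Finset.sum_le_sum hpt
  rw [Finset.sum_const, nsmul_eq_mul] at hsum
  have hsum_univ := Finset.sum_le_univ_sum_of_nonneg
    (s := Finset.univ.filter (fun G : SimpleGraph (Fin n) =>
      ¬ |(upDeg n G S : ℝ) - d| ≤ d ^ ((2 : ℝ) / 3)))
    (f := fun G => Real.exp (t * (upDeg n G S - d)) + Real.exp (-t * (upDeg n G S - d)))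
    (fun G => by positivity)
  have htotal := hsum.trans hsum_univ
  rw [Finset.sum_add_distrib] at htotal
  have hsplit : Real.exp (-(r / 4)) = Real.exp (r / 4) / Real.exp (r / 2) := by
    rw [← Real.exp_sub]
    ring_nf
  rw [hsplit, ← mul_div_assoc, ← mul_div_assoc, le_div_iff₀ (Real.exp_pos _)]
  linarith

open Classical in
theorem card_finset_card_le {n : ℕ} (hn : 1 ≤ n) (m : ℝ) :
    ((Finset.univ.filter (fun S : Finset (Fin n) => (S.card : ℝ) ≤ m)).card : ℝ) ≤
      Real.exp (1 + m * Real.log n) := by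
  have hn0 : (0 : ℝ) < n := by exact_mod_cast hn
  have hlog : 0 ≤ Real.log n := Real.log_nonneg (by exact_mod_cast hn)
  have hpt : ∀ S ∈ Finset.univ.filter (fun S : Finset (Fin n) => (S.card : ℝ) ≤ m),
      Real.exp (-(m * Real.log n)) ≤ (1 / (n : ℝ)) ^ S.card := by
    intro S hS
    rw [Finset.mem_filter] at hS
    have : (1 / (n : ℝ)) ^ S.card = Real.exp (-(S.card * Real.log n)) := by
      rw [Real.exp_neg, Real.exp_nat_mul, Real.exp_log hn0, one_div, inv_pow]
    rw [this]
    gcongr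
    exact hS.2
  have hsum := (Finset.sum_le_sum hpt).trans
    (Finset.sum_le_univ_sum_of_nonneg (fun S => by positivity))
  have htot : ∑ S : Finset (Fin n), (1 / (n : ℝ)) ^ S.card = (1 + 1 / (n : ℝ)) ^ n := by
    have := Fintype.sum_pow_mul_eq_add_pow (Fin n) (1 / (n : ℝ)) 1
    simpa [add_comm] using this
  have he : (1 + 1 / (n : ℝ)) ^ n ≤ Real.exp 1 := by
    calc _ ≤ Real.exp (1 / (n : ℝ)) ^ n := by
          refine pow_le_pow_left₀ (by positivity) ?_ _
          rw [add_comm]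
          exact Real.add_one_le_exp _
      _ = _ := by
          rw [← Real.exp_nat_mul]
          congr 1
          field_simp
  rw [Finset.sum_const, nsmul_eq_mul, htot] at hsum
  rw [Real.exp_add]
  calc _ = (_ * Real.exp (-(m * Real.log n))) * Real.exp (m * Real.log n) := by
        rw [mul_assoc, ← Real.exp_add, neg_add_cancel, Real.exp_zero, mul_one]
    _ ≤ _ := by
        gcongr
        exact hsum.trans he

theorem rpow_logb_div_two_le_meanUpDeg {n k : ℕ} {C : ℝ} (hC : 0 ≤ C)
    (hL : 1 ≤ Real.logb 2 n) (hLn : Real.logb 2 n ≤ n / 2)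
    (hk : (k : ℝ) ≤ Real.logb 2 n - C * Real.logb 2 (Real.logb 2 n)) :
    Real.logb 2 n ^ C / 2 ≤ meanUpDeg n k := by
  set L := Real.logb 2 n with hLdef
  have hn : (0 : ℝ) < n := by linarith
  have hLL : 0 ≤ Real.logb 2 L := Real.logb_nonneg (by norm_num) hL
  have hkL : (k : ℝ) ≤ n / 2 := by nlinarith [mul_nonneg hC hLL]
  have h2 : L ^ C / n ≤ (2 : ℝ) ^ (-(k : ℝ)) := by
    calc L ^ C / n = (2 : ℝ) ^ (C * Real.logb 2 L - L) := by
          rw [Real.rpow_sub (by norm_num), mul_comm, Real.rpow_mul (by norm_num),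
            Real.rpow_logb (by norm_num) (by norm_num) (by linarith), hLdef,
            Real.rpow_logb (by norm_num) (by norm_num) hn]
      _ ≤ _ := Real.rpow_le_rpow_of_exponent_le (by norm_num) (by linarith)
  have hLC : 0 ≤ L ^ C := Real.rpow_nonneg (by linarith) _
  calc L ^ C / 2 = (n / 2) * (L ^ C / n) := by field_simp
    _ ≤ meanUpDeg n k := by
        unfold meanUpDeg
        exact mul_le_mul (by linarith) h2 (by positivity) (by linarith)

open Filter in
theorem tendsto_logb_two_natCast : Tendsto (fun n : ℕ => Real.logb 2 n) atTop atTop :=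
  (Real.tendsto_logb_atTop (by norm_num)).comp tendsto_natCast_atTop_atTop

open Filter in
theorem tendsto_exp_sq_sub_rpow {a : ℝ} (ha : 2 < a) :
    Tendsto (fun x : ℝ => 2 * Real.exp (1 + x ^ 2 - x ^ a / 8)) atTop (nhds 0) := by
  have h1 : Tendsto (fun x : ℝ => x ^ (a - 2) / 8 - 1) atTop atTop :=
    tendsto_atTop_add_const_right _ _
      ((tendsto_rpow_atTop (by linarith)).atTop_div_const (by norm_num))
  have h2 : Tendsto (fun x : ℝ => x ^ 2 * (x ^ (a - 2) / 8 - 1)) atTop atTop :=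
    (tendsto_pow_atTop (by norm_num)).atTop_mul_atTop₀ h1
  have h3 : Tendsto (fun x : ℝ => 1 + -(x ^ 2 * (x ^ (a - 2) / 8 - 1))) atTop atBot :=
    tendsto_atBot_add_const_left _ _ (tendsto_neg_atTop_atBot.comp h2)
  have h4 := (Real.tendsto_exp_atBot.comp h3).const_mul 2
  rw [mul_zero] at h4
  refine h4.congr' ?_
  filter_upwards [eventually_gt_atTop 0] with x hx
  have : x ^ a = x ^ 2 * x ^ (a - 2) := by
    rw [← Real.rpow_natCast, ← Real.rpow_add hx]
    norm_num
  simp only [Function.comp, this]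
  ring_nf

open Classical in
theorem card_exists_upDeg_deviation_le {n : ℕ} {C : ℝ} (hC : 6 < C)
    (hL : 2 ≤ Real.logb 2 n) (hLn : Real.logb 2 n ≤ n / 2) :
    ((Finset.univ.filter (fun G : SimpleGraph (Fin n) => ¬ ∀ S : Finset (Fin n),
      (S.card : ℝ) ≤ Real.logb 2 n - C * Real.logb 2 (Real.logb 2 n) →
      |(upDeg n G S : ℝ) - meanUpDeg n S.card| ≤ meanUpDeg n S.card ^ ((2 : ℝ) / 3))).card : ℝ) ≤
      Fintype.card (SimpleGraph (Fin n)) *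
        (2 * Real.exp (1 + Real.logb 2 n ^ 2 - Real.logb 2 n ^ (C / 3) / 8)) := by
  set L := Real.logb 2 n with hLdef
  set m := L - C * Real.logb 2 L with hm
  set T := (Fintype.card (SimpleGraph (Fin n)) : ℝ) with hT
  have hn : (0 : ℝ) < n := by linarith
  have hn1 : 1 ≤ n := by exact_mod_cast hn
  have hLL : 0 ≤ Real.logb 2 L := Real.logb_nonneg (by norm_num) (by linarith)
  have hmL : m ≤ L := by nlinarith [mul_nonneg (by linarith : (0 : ℝ) ≤ C) hLL]
  have hlog : Real.log n ≤ L := by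
    rw [hLdef, Real.logb, le_div_iff₀ (Real.log_pos (by norm_num))]
    have := Real.log_two_lt_d9
    have := Real.log_nonneg (by exact_mod_cast hn1 : (1 : ℝ) ≤ n)
    nlinarith
  have hlog0 : 0 ≤ Real.log n := Real.log_nonneg (by exact_mod_cast hn1)
  have hpt : ∀ S ∈ Finset.univ.filter (fun S : Finset (Fin n) => (S.card : ℝ) ≤ m),
      ((Finset.univ.filter (fun G : SimpleGraph (Fin n) =>
        ¬ |(upDeg n G S : ℝ) - meanUpDeg n S.card| ≤
          meanUpDeg n S.card ^ ((2 : ℝ) / 3))).card : ℝ) ≤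
        T * (2 * Real.exp (-(L ^ (C / 3) / 8))) := by
    intro S hS
    rw [Finset.mem_filter] at hS
    have hd := rpow_logb_div_two_le_meanUpDeg (by linarith) (by linarith) hLn hS.2
    rw [← hLdef] at hd
    have hLC : L ≤ L ^ C := Real.self_le_rpow_of_one_le (by linarith) (by linarith)
    refine (card_upDeg_deviation_le S (by linarith)).trans ?_
    have h8 : L ^ (C / 3) / 2 ≤ meanUpDeg n S.card ^ ((1 : ℝ) / 3) := by
      calc L ^ (C / 3) / 2 = (L ^ C / 8) ^ ((1 : ℝ) / 3) := by
            rw [Real.div_rpow (by linarith) (by norm_num), ← Real.rpow_mul (by linarith),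
              show (8 : ℝ) = 2 ^ (3 : ℝ) by norm_num, ← Real.rpow_mul (by norm_num)]
            norm_num
            ring_nf
        _ ≤ _ := Real.rpow_le_rpow (by linarith) (by linarith) (by norm_num)
    have hexp : -(meanUpDeg n S.card ^ ((1 : ℝ) / 3) / 4) ≤ -(L ^ (C / 3) / 8) := by linarith
    gcongr
  have hunion : (Finset.univ.filter (fun G : SimpleGraph (Fin n) => ¬ ∀ S : Finset (Fin n),
      (S.card : ℝ) ≤ m →
      |(upDeg n G S : ℝ) - meanUpDeg n S.card| ≤ meanUpDeg n S.card ^ ((2 : ℝ) / 3))) ⊆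
      (Finset.univ.filter (fun S : Finset (Fin n) => (S.card : ℝ) ≤ m)).biUnion
        (fun S => Finset.univ.filter (fun G : SimpleGraph (Fin n) =>
          ¬ |(upDeg n G S : ℝ) - meanUpDeg n S.card| ≤
            meanUpDeg n S.card ^ ((2 : ℝ) / 3))) := by
    intro G hG
    simpa using hG
  have hcard : ((Finset.univ.filter (fun G : SimpleGraph (Fin n) => ¬ ∀ S : Finset (Fin n),
      (S.card : ℝ) ≤ m → |(upDeg n G S : ℝ) - meanUpDeg n S.card| ≤
        meanUpDeg n S.card ^ ((2 : ℝ) / 3))).card : ℝ) ≤ _ :=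
    Nat.cast_le.2 ((Finset.card_le_card hunion).trans Finset.card_biUnion_le)
  rw [Nat.cast_sum] at hcard
  refine (hcard.trans (Finset.sum_le_sum hpt)).trans ?_
  rw [Finset.sum_const, nsmul_eq_mul]
  have hcnt : ((Finset.univ.filter (fun S : Finset (Fin n) => (S.card : ℝ) ≤ m)).card : ℝ) ≤
      Real.exp (1 + L ^ 2) := by
    refine (card_finset_card_le hn1 m).trans (Real.exp_le_exp.2 ?_)
    nlinarith
  calc _ ≤ Real.exp (1 + L ^ 2) * (T * (2 * Real.exp (-(L ^ (C / 3) / 8)))) := by gcongr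
    _ = T * (2 * (Real.exp (1 + L ^ 2) * Real.exp (-(L ^ (C / 3) / 8)))) := by ring
    _ = _ := by rw [← Real.exp_add, sub_eq_add_neg]

open Classical Filter in
theorem stmt16 (C : ℝ) (hC : 6 < C) :
    Tendsto (fun n : ℕ =>
      ((Finset.univ.filter (fun G : SimpleGraph (Fin n) =>
          ∀ S : Finset (Fin n),
            (S.card : ℝ) ≤ Real.logb 2 n - C * Real.logb 2 (Real.logb 2 n) →
            |(upDeg n G S : ℝ) - ((n : ℝ) - S.card) * (2 : ℝ) ^ (-(S.card : ℝ))| ≤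
              (((n : ℝ) - S.card) * (2 : ℝ) ^ (-(S.card : ℝ))) ^ ((2 : ℝ) / 3))).card : ℝ) /
        (Fintype.card (SimpleGraph (Fin n)) : ℝ))
      atTop (nhds 1) := by
  have hhalf : ∀ᶠ n : ℕ in atTop, Real.logb 2 n ≤ n / 2 := by
    have h := (Real.isLittleO_log_id_atTop.comp_tendsto tendsto_natCast_atTop_atTop).def
      (c := Real.log 2 / 2) (by have := Real.log_pos (one_lt_two : (1 : ℝ) < 2); positivity)
    filter_upwards [h] with n hn
    have h2 := Real.log_pos (one_lt_two : (1 : ℝ) < 2)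
    rw [Real.logb, div_le_iff₀ h2]
    simp only [Function.comp, id, Real.norm_eq_abs, Nat.abs_cast] at hn
    linarith [le_abs_self (Real.log n)]
  have hlim := (tendsto_exp_sq_sub_rpow (a := C / 3) (by linarith)).comp tendsto_logb_two_natCast
  have hlow := hlim.const_sub 1
  rw [sub_zero] at hlow
  refine tendsto_of_tendsto_of_tendsto_of_le_of_le' hlow tendsto_const_nhds ?_ ?_
  · filter_upwards [hhalf, tendsto_logb_two_natCast.eventually_ge_atTop 2] with n hn hL
    have hbad := card_exists_upDeg_deviation_le hC hL hn
    have hT : (0 : ℝ) < Fintype.card (SimpleGraph (Fin n)) := by exact_mod_cast Fintype.card_pos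
    have hsplit := Finset.card_filter_add_card_filter_not (s := Finset.univ)
      (fun G : SimpleGraph (Fin n) => ∀ S : Finset (Fin n),
        (S.card : ℝ) ≤ Real.logb 2 n - C * Real.logb 2 (Real.logb 2 n) →
        |(upDeg n G S : ℝ) - meanUpDeg n S.card| ≤ meanUpDeg n S.card ^ ((2 : ℝ) / 3))
    rw [Finset.card_univ, ← Nat.cast_inj (R := ℝ), Nat.cast_add] at hsplit
    rw [le_div_iff₀ hT]
    simp only [Function.comp]
    simp only [meanUpDeg] at hsplit hbad
    linarith
  · refine Eventually.of_forall fun n => div_le_one_of_le₀ ?_ (Nat.cast_nonneg _)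
    exact_mod_cast Finset.card_le_univ _
end
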